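/- Novikov structure of the multi-indice product: (i) for all populated multi-indices β and α, the polynomial z^β · D(z^α) is a linear combination with natural-number coefficients of monomials z^γ with γ populated; in particular span_ℝ{z^β : β populated} is closed under the product u ▷ v := u · D(v). (ii) On all of ℝ[X_0, X_1, …], the product p ▷ q := p · D(q) satisfies the left pre-Lie identity (p ▷ q) ▷ r − p ▷ (q ▷ r) = (q ▷ p) ▷ r − q ▷ (p ▷ r) and the right-commutativity identity (p ▷ q) ▷ r = (p ▷ r) ▷ q. -/

import Mathlib

open MvPolynomial

/-- Multi-indices: finitely supported functions `ℕ → ℕ`. -/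
abbrev MI := ℕ →₀ ℕ

/-- The monomial `z^β = ∏_k X_k^{β k}` in `ℝ[X_0, X_1, …]`. -/
noncomputable def zm (β : MI) : MvPolynomial ℕ ℝ := monomial β 1

/-- `β` is populated if `∑_k (1 - k) β(k) = 1`. -/
def Populated (β : MI) : Prop := (β.sum fun k n => (1 - (k : ℤ)) * n) = 1

/-- The derivation `D` with `D X_k = X_{k+1}`. -/
noncomputable def Dop (p : MvPolynomial ℕ ℝ) : MvPolynomial ℕ ℝ :=
  ∑ᶠ k : ℕ, X (k + 1) * pderiv k p

/-- The span of the monomials `z^β` with `β` populated. -/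
noncomputable def V : Submodule ℝ (MvPolynomial ℕ ℝ) :=
  Submodule.span ℝ {p : MvPolynomial ℕ ℝ | ∃ β : MI, Populated β ∧ p = zm β}

theorem finite_support_Dop (p : MvPolynomial ℕ ℝ) :
    (Function.support fun k : ℕ => X (k + 1) * pderiv k p).Finite := by
  refine p.vars.finite_toSet.subset fun k hk => ?_
  by_contra h
  exact hk (by simp [pderiv_eq_zero_of_notMem_vars h])

theorem Dop_mul (p q : MvPolynomial ℕ ℝ) : Dop (p * q) = p * Dop q + q * Dop p := by
  simp only [Dop]
  rw [mul_finsum, mul_finsum, ← finsum_add_distrib]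
  · refine finsum_congr fun k => ?_
    rw [Derivation.leibniz, smul_eq_mul, smul_eq_mul]
    ring
  · exact (finite_support_Dop q).subset fun k hk h => hk (by simp only [h, mul_zero])
  · exact (finite_support_Dop p).subset fun k hk h => hk (by simp only [h, mul_zero])

theorem Dop_add (p q : MvPolynomial ℕ ℝ) : Dop (p + q) = Dop p + Dop q := by
  simp only [Dop]
  rw [← finsum_add_distrib (finite_support_Dop p) (finite_support_Dop q)]
  exact finsum_congr fun k => by rw [map_add, mul_add]

theorem Dop_smul (a : ℝ) (p : MvPolynomial ℕ ℝ) : Dop (a • p) = a • Dop p := by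
  simp only [Dop]
  rw [smul_finsum]
  exact finsum_congr fun k => by rw [Derivation.map_smul, mul_smul_comm]

theorem Dop_zero : Dop 0 = 0 := by
  simp [Dop]

theorem Dop_zm (α : MI) : Dop (zm α) =
    ∑ k ∈ α.support, (α k : ℝ) • zm (α - Finsupp.single k 1 + Finsupp.single (k + 1) 1) := by
  rw [Dop, finsum_eq_sum_of_support_subset (s := α.support)]
  · refine Finset.sum_congr rfl fun k _ => ?_
    rw [zm, zm, pderiv_monomial, X, monomial_mul, smul_monomial, add_comm]
    simp
  · intro k hk
    by_contra h
    refine hk ?_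
    have h0 : α k = 0 := by simpa using h
    simp [zm, pderiv_monomial, h0]

/-- The weight `∑_k (1 - k) β(k)` of a multi-index. -/
def weight (β : MI) : ℤ := β.sum fun k n => (1 - (k : ℤ)) * n

theorem weight_add (β α : MI) : weight (β + α) = weight β + weight α :=
  Finsupp.sum_add_index' (by simp) (by intros; push_cast; ring)

theorem weight_single (k n : ℕ) : weight (Finsupp.single k n) = (1 - (k : ℤ)) * n :=
  Finsupp.sum_single_index (by simp)

theorem Populated.add_shift {β α : MI} (hβ : Populated β) (hα : Populated α) {k : ℕ}
    (hk : k ∈ α.support) :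
    Populated (β + (α - Finsupp.single k 1 + Finsupp.single (k + 1) 1)) := by
  change weight β = 1 at hβ
  change weight α = 1 at hα
  change weight _ = 1
  have hle : Finsupp.single k 1 ≤ α := by
    rw [Finsupp.single_le_iff]
    exact Nat.one_le_iff_ne_zero.mpr (Finsupp.mem_support_iff.mp hk)
  have h := weight_add (α - Finsupp.single k 1) (Finsupp.single k 1)
  rw [tsub_add_cancel_of_le hle, weight_single] at h
  rw [weight_add, weight_add, weight_single]
  push_cast at h ⊢
  linarith

theorem exists_zm_mul_Dop_zm {β α : MI} (hβ : Populated β) (hα : Populated α) :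
    ∃ c : MI →₀ ℕ, (∀ γ ∈ c.support, Populated γ) ∧
      zm β * Dop (zm α) = c.sum fun γ n => (n : ℝ) • zm γ := by
  refine ⟨∑ k ∈ α.support, Finsupp.single
    (β + (α - Finsupp.single k 1 + Finsupp.single (k + 1) 1)) (α k), fun γ hγ => ?_, ?_⟩
  · obtain ⟨k, hk, hγk⟩ := Finset.mem_biUnion.mp (Finsupp.support_finsetSum hγ)
    rw [Finset.mem_singleton.mp (Finsupp.support_single_subset hγk)]
    exact hβ.add_shift hα hk
  · rw [← Finsupp.sum_finsetSum_index (by simp) (by intros; push_cast; rw [add_smul]), Dop_zm,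
      Finset.mul_sum]
    refine Finset.sum_congr rfl fun k _ => ?_
    rw [Finsupp.sum_single_index (by simp), mul_smul_comm]
    simp [zm, monomial_mul]

theorem mul_Dop_mem_V {u v : MvPolynomial ℕ ℝ} (hu : u ∈ V) (hv : v ∈ V) : u * Dop v ∈ V := by
  induction hv using Submodule.span_induction with
  | zero => rw [Dop_zero, mul_zero]; exact V.zero_mem
  | add x y _ _ hx hy => rw [Dop_add, mul_add]; exact V.add_mem hx hy
  | smul a x _ hx => rw [Dop_smul, mul_smul_comm]; exact V.smul_mem a hx
  | mem x hx =>
    obtain ⟨α, hα, rfl⟩ := hx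
    induction hu using Submodule.span_induction with
    | zero => rw [zero_mul]; exact V.zero_mem
    | add x y _ _ hx hy => rw [add_mul]; exact V.add_mem hx hy
    | smul a x _ hx => rw [smul_mul_assoc]; exact V.smul_mem a hx
    | mem x hx =>
      obtain ⟨β, hβ, rfl⟩ := hx
      obtain ⟨c, hc, h⟩ := exists_zm_mul_Dop_zm hβ hα
      rw [h]
      exact V.sum_mem fun γ hγ => V.smul_mem _ (Submodule.subset_span ⟨γ, hc γ hγ, rfl⟩)


/-- Novikov structure of the multi-indice product `p ▷ q = p · D q`:
(i) for populated `β, α` the product `z^β · D(z^α)` is an ℕ-linear combination of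
populated monomials, so the populated span is closed under `▷`;
(ii) `▷` satisfies the left pre-Lie identity and right-commutativity. -/
theorem Novikov_structure_of_multiindice_product :
    (∀ β α : MI, Populated β → Populated α → ∃ c : MI →₀ ℕ,
      (∀ γ ∈ c.support, Populated γ) ∧
      zm β * Dop (zm α) = c.sum fun γ n => (n : ℝ) • zm γ) ∧
    (∀ u v : MvPolynomial ℕ ℝ, u ∈ V → v ∈ V → u * Dop v ∈ V) ∧
    (∀ p q r : MvPolynomial ℕ ℝ,
      ((p * Dop q) * Dop r - p * Dop (q * Dop r)
          = (q * Dop p) * Dop r - q * Dop (p * Dop r)) ∧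
      (p * Dop q) * Dop r = (p * Dop r) * Dop q) := by
  refine ⟨fun _ _ => exists_zm_mul_Dop_zm, fun _ _ => mul_Dop_mem_V, fun p q r => ⟨?_, ?_⟩⟩
  · rw [Dop_mul, Dop_mul]
    ring
  · ring
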